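/- Let A, B ∈ ℝ^{3×3} be polytropes. Then A ⊙ B = B ⊙ A if and only if A ⊕ B = (A ⊕ B)*. -/

import Mathlib

namespace TropComm

variable {n : ℕ}

/-- Tropical (min-plus) matrix product: `(A ⊙ B) i j = min_s (A i s + B s j)`. -/
def tropMul [NeZero n] (A B : Fin n → Fin n → ℝ) : Fin n → Fin n → ℝ :=
  fun i j => Finset.univ.inf' Finset.univ_nonempty (fun s => A i s + B s j)

/-- Tropical matrix-vector product: `(A ⊙ x) i = min_j (A i j + x j)`. -/
def tropMulVec [NeZero n] (A : Fin n → Fin n → ℝ) (x : Fin n → ℝ) : Fin n → ℝ :=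
  fun i => Finset.univ.inf' Finset.univ_nonempty (fun j => A i j + x j)

/-- Tropical sum: entrywise minimum. -/
def tropSum (A B : Fin n → Fin n → ℝ) : Fin n → Fin n → ℝ :=
  fun i j => min (A i j) (B i j)

/-- `tropPow A k` is the k-fold tropical product `A^{⊙k}` (with the junk value
`tropPow A 0 = A`; only exponents `k ≥ 1` are ever used). -/
def tropPow [NeZero n] (A : Fin n → Fin n → ℝ) : ℕ → (Fin n → Fin n → ℝ)
  | 0 => A
  | 1 => A
  | (k + 2) => tropMul A (tropPow A (k + 1))

/-- Kleene star `A* = A ⊕ A^{⊙2} ⊕ ⋯ ⊕ A^{⊙n}`. -/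
def kleene [NeZero n] (A : Fin n → Fin n → ℝ) : Fin n → Fin n → ℝ :=
  fun i j => Finset.univ.inf' Finset.univ_nonempty (fun k : Fin n => tropPow A (k.val + 1) i j)

/-- A premetric: zero diagonal, positive off-diagonal entries. -/
def IsPremetric (A : Fin n → Fin n → ℝ) : Prop :=
  (∀ i, A i i = 0) ∧ ∀ i j, i ≠ j → 0 < A i j

/-- A polytrope: a premetric satisfying the triangle inequality. -/
def IsPolytrope (A : Fin n → Fin n → ℝ) : Prop :=
  IsPremetric A ∧ ∀ i j k, A i j ≤ A i k + A k j


lemma tropMul_le [NeZero n] (A B : Fin n → Fin n → ℝ) (i j s : Fin n) :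
    tropMul A B i j ≤ A i s + B s j :=
  Finset.inf'_le _ (Finset.mem_univ s)

lemma exists_tropMul_eq [NeZero n] (A B : Fin n → Fin n → ℝ) (i j : Fin n) :
    ∃ s, tropMul A B i j = A i s + B s j := by
  obtain ⟨s, -, hs⟩ := Finset.exists_mem_eq_inf' Finset.univ_nonempty (fun s => A i s + B s j)
  exact ⟨s, hs⟩

lemma IsPremetric.nonneg {A : Fin n → Fin n → ℝ} (hA : IsPremetric A) (i j : Fin n) :
    0 ≤ A i j := by
  rcases eq_or_ne i j with rfl | h
  · exact (hA.1 i).ge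
  · exact (hA.2 i j h).le

lemma IsPremetric.tropSum {A B : Fin n → Fin n → ℝ} (hA : IsPremetric A) (hB : IsPremetric B) :
    IsPremetric (tropSum A B) :=
  ⟨fun i => by simp [TropComm.tropSum, hA.1 i, hB.1 i],
    fun i j h => lt_min (hA.2 i j h) (hB.2 i j h)⟩

lemma tropMul_le_tropSum [NeZero n] {A B : Fin n → Fin n → ℝ}
    (hA : IsPremetric A) (hB : IsPremetric B) (i j : Fin n) :
    tropMul A B i j ≤ tropSum A B i j := by
  have h₁ := tropMul_le A B i j j
  have h₂ := tropMul_le A B i j i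
  rw [hB.1, add_zero] at h₁
  rw [hA.1, zero_add] at h₂
  exact le_min h₁ h₂

lemma tropSum_comm (A B : Fin n → Fin n → ℝ) : tropSum A B = tropSum B A :=
  funext fun _ => funext fun _ => min_comm _ _

lemma le_tropPow [NeZero n] {C : Fin n → Fin n → ℝ} (hC : ∀ i j k, C i j ≤ C i k + C k j)
    (m : ℕ) (i j : Fin n) : C i j ≤ tropPow C (m + 1) i j := by
  induction m generalizing i j with
  | zero => exact le_rfl
  | succ m ih =>
    obtain ⟨s, hs⟩ := exists_tropMul_eq C (tropPow C (m + 1)) i j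
    calc C i j ≤ C i s + C s j := hC i j s
      _ ≤ C i s + tropPow C (m + 1) s j := by gcongr; exact ih s j
      _ = tropPow C (m + 1 + 1) i j := hs.symm

/-- In dimension at least two, a matrix equals its Kleene star exactly when it satisfies the
triangle inequality. -/
lemma eq_kleene_iff [NeZero n] (hn : 2 ≤ n) (C : Fin n → Fin n → ℝ) :
    C = kleene C ↔ ∀ i j k, C i j ≤ C i k + C k j := by
  constructor
  · intro h i j k
    calc C i j = kleene C i j := congrFun (congrFun h i) j
      _ ≤ tropPow C 2 i j :=
        Finset.inf'_le (fun k : Fin n => tropPow C (k.val + 1) i j)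
          (Finset.mem_univ (⟨1, hn⟩ : Fin n))
      _ ≤ C i k + C k j := tropMul_le C C i j k
  · intro h
    funext i j
    refine le_antisymm (Finset.le_inf' _ _ fun k _ => le_tropPow h k i j) ?_
    exact Finset.inf'_le (fun k : Fin n => tropPow C (k.val + 1) i j)
      (Finset.mem_univ (⟨0, by lia⟩ : Fin n))

lemma tropMul_eq_tropSum [NeZero n] {A B : Fin n → Fin n → ℝ}
    (hA : IsPremetric A) (hB : IsPremetric B)
    (h : ∀ i j k, tropSum A B i j ≤ tropSum A B i k + tropSum A B k j) :
    tropMul A B = tropSum A B := by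
  funext i j
  refine le_antisymm (tropMul_le_tropSum hA hB i j) (Finset.le_inf' _ _ fun s _ => ?_)
  exact (h i j s).trans (add_le_add (min_le_left _ _) (min_le_right _ _))

lemma tropMul_eq_min {A B : Fin 3 → Fin 3 → ℝ} (hA : IsPremetric A) (hB : IsPremetric B)
    {i j k : Fin 3} (hij : i ≠ j) (hik : i ≠ k) (hkj : k ≠ j) :
    tropMul A B i j = min (tropSum A B i j) (A i k + B k j) := by
  refine le_antisymm (le_min (tropMul_le_tropSum hA hB i j) (tropMul_le A B i j k)) ?_
  obtain ⟨s, hs⟩ := exists_tropMul_eq A B i j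
  have hs' : s = i ∨ s = j ∨ s = k := by lia
  rw [hs]
  rcases hs' with rfl | rfl | rfl
  · rw [hA.1, zero_add]
    exact (min_le_left _ _).trans (min_le_right _ _)
  · rw [hB.1, add_zero]
    exact (min_le_left _ _).trans (min_le_left _ _)
  · exact min_le_right _ _

lemma tropSum_le_add_of_commute {A B : Fin 3 → Fin 3 → ℝ} (hA : IsPolytrope A)
    (hB : IsPolytrope B) (h : tropMul A B = tropMul B A) {i j k : Fin 3}
    (hij : i ≠ j) (hik : i ≠ k) (hkj : k ≠ j) :
    tropSum A B i j ≤ A i k + B k j := by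
  by_contra! hlt
  have h' := congrFun (congrFun h i) j
  rw [tropMul_eq_min hA.1 hB.1 hij hik hkj, tropMul_eq_min hB.1 hA.1 hij hik hkj,
    tropSum_comm B A, min_eq_right hlt.le] at h'
  have heq : A i k + B k j = B i k + A k j := by
    rcases min_choice (tropSum A B i j) (B i k + A k j) with h₁ | h₁ <;> linarith
  have hAlt : A i k + B k j < A i j := hlt.trans_le (min_le_left _ _)
  have hBlt : A i k + B k j < B i j := hlt.trans_le (min_le_right _ _)
  linarith [hA.2 i j k, hB.2 i j k]

lemma tropSum_triangle_of_commute {A B : Fin 3 → Fin 3 → ℝ} (hA : IsPolytrope A)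
    (hB : IsPolytrope B) (h : tropMul A B = tropMul B A) (i j k : Fin 3) :
    tropSum A B i j ≤ tropSum A B i k + tropSum A B k j := by
  have hC := hA.1.tropSum hB.1
  rcases eq_or_ne i j with rfl | hij
  · rw [hC.1]
    exact add_nonneg (hC.nonneg _ _) (hC.nonneg _ _)
  rcases eq_or_ne i k with rfl | hik
  · rw [hC.1, zero_add]
  rcases eq_or_ne k j with rfl | hkj
  · rw [hC.1, add_zero]
  have hAB := tropSum_le_add_of_commute hA hB h hij hik hkj
  have hBA := tropSum_le_add_of_commute hB hA h.symm hij hik hkj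
  rw [tropSum_comm B A] at hBA
  have hAA : tropSum A B i j ≤ A i k + A k j := (min_le_left _ _).trans (hA.2 i j k)
  have hBB : tropSum A B i j ≤ B i k + B k j := (min_le_right _ _).trans (hB.2 i j k)
  rcases min_choice (A i k) (B i k) with h₁ | h₁ <;>
    rcases min_choice (A k j) (B k j) with h₂ | h₂ <;>
    simpa only [tropSum, h₁, h₂] using ‹_›

/-- For 3×3 polytropes `A, B`,
`A ⊙ B = B ⊙ A` iff `A ⊕ B = (A ⊕ B)*`. -/
theorem stmt3 (A B : Fin 3 → Fin 3 → ℝ)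
    (hA : IsPolytrope A) (hB : IsPolytrope B) :
    tropMul A B = tropMul B A ↔ tropSum A B = kleene (tropSum A B) := by
  rw [eq_kleene_iff (by norm_num)]
  refine ⟨tropSum_triangle_of_commute hA hB, fun h => ?_⟩
  rw [tropMul_eq_tropSum hA.1 hB.1 h, tropSum_comm A B,
    tropMul_eq_tropSum hB.1 hA.1 (tropSum_comm A B ▸ h)]

end TropComm
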